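/- Let G be a finite group satisfying o(G) < 31/12, and let n_2(G) be the number of elements of order 2 in G. Then exactly one of the following holds: (a) G is a 2-group whose commutator subgroup equals its Frattini subgroup, i.e. G' = Φ(G), and n_2(G) > (17/24)|G| − 3/2; (b) G is isomorphic to the cyclic group C_3; (c) G contains a normal elementary abelian 3-subgroup K of order 3^m (for some m ≥ 1) of index 2 such that every element of G outside K has order 2 (so G is a Frobenius group with kernel K and cyclic complement of order 2), and in this case o(G) = (5·3^m − 2)/(2·3^m). -/

import Mathlib

/-- The sum of the orders of all elements of `G`. -/
noncomputable def psi (G : Type*) [Group G] : ℕ := ∑ᶠ x : G, orderOf x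

/-- The average order of a finite group `G`, as a rational number. -/
noncomputable def avgOrder (G : Type*) [Group G] : ℚ := psi G / Nat.card G

/-- The number of elements of order `d` in `G`. -/
noncomputable def nOrd (G : Type*) [Group G] (d : ℕ) : ℕ := Nat.card {x : G // orderOf x = d}

/-- A group is supersolvable if it has a chain of subgroups
`⊥ = H 0 ≤ H 1 ≤ … ≤ H n = ⊤`, each normal in `G`, with all successive
quotients cyclic. -/
def IsSupersolvable (G : Type*) [Group G] : Prop :=
  ∃ (n : ℕ) (H : Fin (n + 1) → Subgroup G) (hnorm : ∀ i, (H i).Normal),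
    H 0 = ⊥ ∧ H (Fin.last n) = ⊤ ∧
    (∀ i : Fin n, H i.castSucc ≤ H i.succ) ∧
    ∀ i : Fin n,
      letI := (hnorm i.castSucc).subgroupOf (H i.succ)
      IsCyclic (↥(H i.succ) ⧸ (H i.castSucc).subgroupOf (H i.succ))

/-- Clause (a): `G` is a `2`-group with `G' = Φ(G)` and `n₂(G) > (17/24)|G| - 3/2`. -/
def ClauseA (G : Type*) [Group G] : Prop :=
  (∃ k : ℕ, Nat.card G = 2 ^ k) ∧ commutator G = frattini G ∧
    (nOrd G 2 : ℚ) > 17 / 24 * (Nat.card G : ℚ) - 3 / 2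

/-- Clause (b): `G ≅ C₃`. -/
def ClauseB (G : Type*) [Group G] : Prop := Nonempty (G ≃* Multiplicative (ZMod 3))

/-- Clause (c): `G` has a normal elementary abelian `3`-subgroup `K` of order `3 ^ m`
(`m ≥ 1`) and index `2`, every element outside `K` has order `2`, and
`o(G) = (5 · 3 ^ m - 2)/(2 · 3 ^ m)`. -/
def ClauseC (G : Type*) [Group G] : Prop :=
  ∃ (m : ℕ) (K : Subgroup G), 1 ≤ m ∧ K.Normal ∧
    Nat.card K = 3 ^ m ∧ K.index = 2 ∧
    (∀ x ∈ K, ∀ y ∈ K, x * y = y * x) ∧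
    (∀ x ∈ K, x ≠ 1 → orderOf x = 3) ∧
    (∀ x : G, x ∉ K → orderOf x = 2) ∧
    avgOrder G = (5 * 3 ^ m - 2 : ℚ) / (2 * 3 ^ m)

open Finset

lemma sum_shift_eq {G : Type*} [Group G] [Fintype G] (x : G) (f : G → ℤ) :
    ∑ g, (f g + f (g * x) + f (g * x ^ 2)) = 3 * ∑ g, f g := by
  have h (y : G) : ∑ g, f (g * y) = ∑ g, f g := Equiv.sum_comp (Equiv.mulRight y) f
  rw [sum_add_distrib, sum_add_distrib, h, h]
  ring

lemma sum_ite_one_eq_card {G : Type*} [Fintype G] (p : G → Prop) [DecidablePred p] :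
    ∑ g, (if p g then (1 : ℤ) else 0) = Nat.card {g // p g} := by
  simp [Fintype.card_subtype]

section Orders

variable {G : Type*} [Group G] [Finite G]

lemma two_le_orderOf {g : G} (h : g ≠ 1) : 2 ≤ orderOf g := by
  have := orderOf_pos g
  have := orderOf_eq_one_iff.not.mpr h
  omega

lemma three_le_orderOf {g : G} (h : g ^ 2 ≠ 1) : 3 ≤ orderOf g := by
  have h2 : 2 ≤ orderOf g := two_le_orderOf (by rintro rfl; simp at h)
  have : orderOf g ≠ 2 := fun h' => h (h' ▸ pow_orderOf_eq_one g)
  omega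

lemma four_le_orderOf {g : G} (h : g ^ 2 ≠ 1) (h3 : orderOf g ≠ 3) : 4 ≤ orderOf g := by
  have := three_le_orderOf h
  omega

end Orders

section Inverted

variable {G : Type*} [Group G]

lemma inverts_of_sq_eq_one {a y : G} (ha : a ^ 2 = 1) (hay : (a * y) ^ 2 = 1) :
    a * y = y⁻¹ * a := by
  have h1 : a * y * a * y = 1 := by rw [← hay, sq]; group
  have h2 : a⁻¹ = a := inv_eq_of_mul_eq_one_right (by rw [← sq, ha])
  calc a * y = (a * y * a * y) * y⁻¹ * a⁻¹ := by group
    _ = y⁻¹ * a := by rw [h1, h2, one_mul]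

lemma inverts_of_inverts_sq {a x : G} (hx : Odd (orderOf x)) (h : a * x ^ 2 = (x ^ 2)⁻¹ * a) :
    a * x = x⁻¹ * a := by
  obtain ⟨m, hm⟩ := hx
  have hxm : (x ^ 2) ^ (m + 1) = x := by
    rw [← pow_mul, show 2 * (m + 1) = orderOf x + 1 by omega, pow_succ, pow_orderOf_eq_one, one_mul]
  have h1 : SemiconjBy a (x ^ 2) (x ^ 2)⁻¹ := h
  have h2 := h1.pow_right (m + 1)
  rwa [inv_pow, hxm] at h2

lemma orderOf_mul_of_not_dvd {p : ℕ} (hp : p.Prime) {g x : G} (hx : orderOf x = p)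
    (hC : Commute g x) (hg : ¬ p ∣ orderOf g) : orderOf (g * x) = orderOf g * p := by
  rw [hC.orderOf_mul_eq_mul_orderOf_of_coprime, hx]
  rw [hx]
  exact ((Nat.Prime.coprime_iff_not_dvd hp).mpr hg).symm

lemma orderOf_sq_eq {p : ℕ} {x : G} (hx : orderOf x = p) (hodd : Odd p) : orderOf (x ^ 2) = p := by
  rw [Nat.Coprime.orderOf_pow, hx]
  rw [hx]
  exact hodd.coprime_two_right

lemma orderOf_sum_cases {p : ℕ} (hp : p.Prime) (hodd : Odd p) {g x : G} (hx : orderOf x = p)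
    (hC : Commute g x) :
    (p ∣ orderOf g ∧ p ∣ orderOf (g * x) ∧ p ∣ orderOf (g * x ^ 2)) ∨
    ∃ y ∈ ({g, g * x, g * x ^ 2} : Set G),
      orderOf g + orderOf (g * x) + orderOf (g * x ^ 2) = orderOf y * (2 * p + 1) := by
  have hx2 := orderOf_sq_eq hx hodd
  have hx1 : orderOf x⁻¹ = p := by rwa [orderOf_inv]
  have hx3 : orderOf (x ^ 2)⁻¹ = p := by rwa [orderOf_inv]
  have hc2 : Commute g (x ^ 2) := hC.pow_right 2
  have hcx : Commute (g * x) x := hC.mul_left (.refl x)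
  have hcx2 : Commute (g * x ^ 2) x := hC.mul_left ((Commute.refl x).pow_left 2)
  by_cases h0 : p ∣ orderOf g
  · by_cases h1 : p ∣ orderOf (g * x)
    · by_cases h2 : p ∣ orderOf (g * x ^ 2)
      · exact .inl ⟨h0, h1, h2⟩
      · refine .inr ⟨g * x ^ 2, by simp, ?_⟩
        have e0 := orderOf_mul_of_not_dvd hp hx3 (hcx2.pow_right 2).inv_right h2
        have e1 := orderOf_mul_of_not_dvd hp hx1 hcx2.inv_right h2
        rw [show g * x ^ 2 * (x ^ 2)⁻¹ = g by group] at e0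
        rw [show g * x ^ 2 * x⁻¹ = g * x by group] at e1
        rw [e0, e1]; ring
    · refine .inr ⟨g * x, by simp, ?_⟩
      have e0 := orderOf_mul_of_not_dvd hp hx1 hcx.inv_right h1
      have e1 := orderOf_mul_of_not_dvd hp hx hcx h1
      rw [show g * x * x⁻¹ = g by group] at e0
      rw [mul_assoc, ← sq] at e1
      rw [e0, e1]; ring
  · refine .inr ⟨g, by simp, ?_⟩
    have e0 := orderOf_mul_of_not_dvd hp hx hC h0
    have e1 := orderOf_mul_of_not_dvd hp hx2 hc2 h0
    rw [e0, e1]; ring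

variable [Finite G]

lemma eight_le_orderOf_sum {g x : G} (hx : Odd (orderOf x)) (hC : g * x ≠ x * g)
    (hI : g * x ≠ x⁻¹ * g) : 8 ≤ orderOf g + orderOf (g * x) + orderOf (g * x ^ 2) ∧
    10 ≤ (orderOf g + if orderOf g = 3 then 1 else 0) +
      (orderOf (g * x) + if orderOf (g * x) = 3 then 1 else 0) +
      (orderOf (g * x ^ 2) + if orderOf (g * x ^ 2) = 3 then 1 else 0) := by
  have ne1 (y : G) (hy : Commute y x) : g * y ≠ 1 := by
    intro h
    rw [mul_eq_one_iff_eq_inv] at h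
    exact hC (h ▸ hy.inv_left)
  have h0 : g ≠ 1 := by rintro rfl; simp at hC
  have h1 : g * x ≠ 1 := ne1 x (.refl x)
  have h2 : g * x ^ 2 ≠ 1 := ne1 _ (Commute.pow_left rfl 2)
  have h01 : g ^ 2 = 1 → (g * x) ^ 2 ≠ 1 := fun h h' => hI (inverts_of_sq_eq_one h h')
  have h02 : g ^ 2 = 1 → (g * x ^ 2) ^ 2 ≠ 1 := fun h h' =>
    hI (inverts_of_inverts_sq hx (inverts_of_sq_eq_one h h'))
  have h12 : (g * x) ^ 2 = 1 → (g * x ^ 2) ^ 2 ≠ 1 := fun h h' => by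
    have h3 := inverts_of_sq_eq_one (y := x) h (by rwa [sq x, ← mul_assoc] at h')
    exact hI (mul_right_cancel (b := x) (by simpa only [mul_assoc] using h3))
  have a0 := two_le_orderOf h0
  have a1 := two_le_orderOf h1
  have a2 := two_le_orderOf h2
  have b0 := three_le_orderOf (g := g)
  have b1 := three_le_orderOf (g := g * x)
  have b2 := three_le_orderOf (g := g * x ^ 2)
  by_cases c0 : g ^ 2 = 1 <;> by_cases c1 : (g * x) ^ 2 = 1 <;>
    by_cases c2 : (g * x ^ 2) ^ 2 = 1 <;> grind

lemma six_le_orderOf_sum {g x : G} (hC : g * x ≠ x * g) :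
    6 ≤ orderOf g + orderOf (g * x) + orderOf (g * x ^ 2) := by
  have ne1 (y : G) (hy : Commute y x) : g * y ≠ 1 := by
    intro h
    rw [mul_eq_one_iff_eq_inv] at h
    exact hC (h ▸ hy.inv_left)
  have h0 : g ≠ 1 := by rintro rfl; simp at hC
  have a0 := two_le_orderOf h0
  have a1 := two_le_orderOf (ne1 x (.refl x))
  have a2 := two_le_orderOf (ne1 _ (Commute.pow_left rfl 2))
  omega

lemma eleven_le_orderOf_sum {p : ℕ} (hp : p.Prime) (hp5 : 5 ≤ p) {g x : G} (hx : orderOf x = p)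
    (hC : Commute g x) : 11 ≤ orderOf g + orderOf (g * x) + orderOf (g * x ^ 2) := by
  rcases orderOf_sum_cases hp (hp.odd_of_ne_two (by omega)) hx hC with ⟨h0, h1, h2⟩ | ⟨y, -, h⟩
  · have := Nat.le_of_dvd (orderOf_pos _) h0
    have := Nat.le_of_dvd (orderOf_pos _) h1
    have := Nat.le_of_dvd (orderOf_pos _) h2
    omega
  · rw [h]
    have := orderOf_pos y
    nlinarith

lemma seven_le_orderOf_sum {g x : G} (hx : orderOf x = 3) (hC : Commute g x) :
    7 ≤ orderOf g + orderOf (g * x) + orderOf (g * x ^ 2) ∧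
    (g ∉ Subgroup.zpowers x → 9 ≤ orderOf g + orderOf (g * x) + orderOf (g * x ^ 2)) ∧
    (g ^ 3 ≠ 1 → 14 ≤ orderOf g + orderOf (g * x) + orderOf (g * x ^ 2)) := by
  have hx3 : x ^ 3 = 1 := hx ▸ pow_orderOf_eq_one x
  have key (y : G) (hy : y ^ 3 = g ^ 3) : g ^ 3 ≠ 1 → orderOf y ≠ 3 := by
    intro h h'
    rw [← hy, ← h', pow_orderOf_eq_one] at h
    exact h rfl
  have k1 : (g * x) ^ 3 = g ^ 3 := by rw [hC.mul_pow, hx3, mul_one]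
  have k2 : (g * x ^ 2) ^ 3 = g ^ 3 := by
    rw [(hC.pow_right 2).mul_pow, ← pow_mul, mul_comm 2, pow_mul, hx3, one_pow, mul_one]
  rcases orderOf_sum_cases Nat.prime_three (by decide) hx hC with ⟨h0, h1, h2⟩ | ⟨y, hy, h⟩
  · have p0 := orderOf_pos g
    have p1 := orderOf_pos (g * x)
    have p2 := orderOf_pos (g * x ^ 2)
    have q0 := key _ rfl
    have q1 := key _ k1
    have q2 := key _ k2
    refine ⟨by omega, fun _ => by omega, fun h3 => ?_⟩
    have := q0 h3
    have := q1 h3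
    have := q2 h3
    omega
  · have hy0 := orderOf_pos y
    have hy3 : y ^ 3 = g ^ 3 := by rcases hy with rfl | rfl | rfl <;> [rfl; exact k1; exact k2]
    rw [h]
    by_cases hy1 : y = 1
    · subst hy1
      have hg : g ∈ Subgroup.zpowers x := by
        rcases hy with hy | hy | hy
        · rw [← hy]; exact one_mem _
        · rw [eq_inv_of_mul_eq_one_left hy.symm]
          exact inv_mem (Subgroup.mem_zpowers x)
        · rw [eq_inv_of_mul_eq_one_left (b := x ^ 2) hy.symm]
          exact inv_mem (pow_mem (Subgroup.mem_zpowers x) 2)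
      rw [one_pow] at hy3
      exact ⟨by omega, fun h => absurd hg h, fun h => absurd hy3.symm h⟩
    · have := two_le_orderOf hy1
      exact ⟨by omega, fun _ => by omega, fun _ => by omega⟩

end Inverted

section Counting

variable {G : Type*} [Group G]

/-- The elements centralizing or inverting `x`. -/
def invCentralizer (x : G) : Subgroup G where
  carrier := {g | g * x = x * g ∨ g * x = x⁻¹ * g}
  one_mem' := by simp
  mul_mem' := by
    intro a b ha hb
    have ha : SemiconjBy a x x ∨ SemiconjBy a x x⁻¹ := ha
    have hb : SemiconjBy b x x ∨ SemiconjBy b x x⁻¹ := hb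
    rcases ha with ha | ha <;> rcases hb with hb | hb
    · exact .inl (ha.mul_left hb)
    · exact .inr (ha.inv_right.mul_left hb)
    · exact .inr (ha.mul_left hb)
    · left
      have := ha.inv_right.mul_left hb
      rwa [inv_inv] at this
  inv_mem' := by
    intro a ha
    have ha : SemiconjBy a x x ∨ SemiconjBy a x x⁻¹ := ha
    rcases ha with ha | ha
    · exact .inl ha.inv_symm_left
    · right
      have := ha.inv_symm_left.inv_right
      rwa [inv_inv] at this

lemma mem_invCentralizer {x g : G} :
    g ∈ invCentralizer x ↔ g * x = x * g ∨ g * x = x⁻¹ * g := Iff.rfl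

lemma natCard_commuting_eq (x : G) :
    Nat.card {g // g * x = x * g} = Nat.card (Subgroup.centralizer {x}) :=
  Nat.card_congr (Equiv.subtypeEquivRight fun _ => by rw [Subgroup.mem_centralizer_singleton_iff])

lemma natCard_inverting_eq {x t : G} (ht : t * x = x⁻¹ * t) :
    Nat.card {g // g * x = x⁻¹ * g} = Nat.card (Subgroup.centralizer {x}) := by
  rw [← natCard_commuting_eq]
  refine Nat.card_congr ((Equiv.mulLeft t⁻¹).subtypeEquiv fun g => ?_)
  have h1 : t⁻¹ * x⁻¹ = x * t⁻¹ := by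
    have : SemiconjBy t x x⁻¹ := ht
    exact this.inv_symm_left
  rw [Equiv.coe_mulLeft, mul_assoc, ← mul_assoc x, ← h1, mul_assoc t⁻¹, mul_right_inj]

lemma not_inverting_of_commute {x g : G} (hx : Odd (orderOf x)) (hx1 : x ≠ 1)
    (h : g * x = x * g) : g * x ≠ x⁻¹ * g := by
  intro h'
  rw [h, mul_left_inj, eq_inv_iff_mul_eq_one, ← sq] at h'
  have h2 := orderOf_dvd_of_pow_eq_one h'
  have := hx.coprime_two_right.eq_one_of_dvd h2
  exact hx1 (orderOf_eq_one_iff.mp this)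

lemma natCard_inverting_le (x : G) :
    Nat.card {g // g * x = x⁻¹ * g} ≤ Nat.card (Subgroup.centralizer {x}) := by
  by_cases ht : ∃ t, t * x = x⁻¹ * t
  · exact (natCard_inverting_eq ht.choose_spec).le
  · push Not at ht
    have : IsEmpty {g // g * x = x⁻¹ * g} := ⟨fun g => ht g.1 g.2⟩
    simp

lemma psi_eq_sum [Fintype G] : (psi G : ℤ) = ∑ g : G, (orderOf g : ℤ) := by
  rw [psi, finsum_eq_sum_of_fintype, Nat.cast_sum]

lemma sum_le_three_mul_psi [Fintype G] (x : G) (w : G → ℤ)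
    (h : ∀ g, w g ≤ orderOf g + orderOf (g * x) + orderOf (g * x ^ 2)) :
    ∑ g, w g ≤ 3 * psi G := by
  rw [psi_eq_sum, ← sum_shift_eq x]
  exact Finset.sum_le_sum fun g _ => h g

variable [Finite G]

lemma natCard_invCentralizer {x t : G} (hx : Odd (orderOf x)) (hx1 : x ≠ 1)
    (ht : t * x = x⁻¹ * t) :
    Nat.card (invCentralizer x) = 2 * Nat.card (Subgroup.centralizer {x}) := by
  classical
  have := Fintype.ofFinite G
  have h := Nat.card_congr (subtypeOrEquiv (fun g : G => g * x = x * g) (fun g => g * x = x⁻¹ * g)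
    (by
      rw [Pi.disjoint_iff]
      intro g
      rw [Prop.disjoint_iff]
      by_contra! hg
      exact not_inverting_of_commute hx hx1 hg.1 hg.2))
  rw [Nat.card_sum, natCard_commuting_eq, natCard_inverting_eq ht, ← two_mul] at h
  exact h

lemma twelve_mul_psi_lt (h : avgOrder G < 31 / 12) : 12 * (psi G : ℤ) < 31 * Nat.card G := by
  have hG : (0 : ℚ) < Nat.card G := by exact_mod_cast Nat.card_pos
  rw [avgOrder, div_lt_div_iff₀ hG (by norm_num)] at h
  have h' : (psi G : ℚ) * 12 < 31 * Nat.card G := h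
  rw [mul_comm]
  exact_mod_cast h'

lemma five_le_prime_bound {p : ℕ} (hp : p.Prime) (hp5 : 5 ≤ p) (hpG : p ∣ Nat.card G) :
    8 * (Nat.card G : ℤ) ≤ 3 * psi G := by
  classical
  have := Fintype.ofFinite G
  have : Fact p.Prime := ⟨hp⟩
  obtain ⟨x, hx⟩ := exists_prime_orderOf_dvd_card' p hpG
  have hodd : Odd (orderOf x) := hx ▸ hp.odd_of_ne_two (by omega)
  have hx1 : x ≠ 1 := by rintro rfl; rw [orderOf_one] at hx; omega
  have key := sum_le_three_mul_psi x
    (fun g => 8 + 3 * (if g * x = x * g then (1 : ℤ) else 0)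
      + (-2) * (if g * x = x⁻¹ * g then (1 : ℤ) else 0)) (by
      intro g
      by_cases hC : g * x = x * g
      · have h1 := eleven_le_orderOf_sum hp hp5 hx hC
        have h2 := not_inverting_of_commute hodd hx1 hC
        rw [if_pos hC, if_neg h2]
        omega
      · by_cases hI : g * x = x⁻¹ * g
        · have := six_le_orderOf_sum hC
          rw [if_neg hC, if_pos hI]
          omega
        · have := (eight_le_orderOf_sum hodd hC hI).1
          rw [if_neg hC, if_neg hI]
          omega)
  rw [sum_add_distrib, sum_add_distrib, ← mul_sum, ← mul_sum, sum_ite_one_eq_card,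
    sum_ite_one_eq_card, natCard_commuting_eq, sum_const, card_univ, ← Nat.card_eq_fintype_card,
    nsmul_eq_mul] at key
  have := natCard_inverting_le x
  omega

end Counting

section OrderThree

variable {G : Type*} [Group G]

lemma mem_zpowers_of_orderOf_eq_three {x g : G} (hx : orderOf x = 3)
    (hg : g ∈ Subgroup.zpowers x) : g = 1 ∨ g = x ∨ g = x⁻¹ := by
  have hx3 : x ^ 3 = 1 := hx ▸ pow_orderOf_eq_one x
  have hfin : IsOfFinOrder x := orderOf_pos_iff.mp (by omega)
  classical
  obtain ⟨k, hk, rfl⟩ := Finset.mem_image.mp (hfin.mem_zpowers_iff_mem_range_orderOf.mp hg)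
  rw [hx, Finset.mem_range] at hk
  interval_cases k
  · simp
  · simp
  · right; right
    rw [eq_inv_iff_mul_eq_one, ← pow_succ, hx3]

lemma zpowers_le_centralizer (x : G) : Subgroup.zpowers x ≤ Subgroup.centralizer {x} := by
  rw [Subgroup.zpowers_le, Subgroup.mem_centralizer_singleton_iff]

lemma three_dvd_natCard_centralizer {x : G} (hx : orderOf x = 3) :
    3 ∣ Nat.card (Subgroup.centralizer {x}) := by
  rw [← hx, ← Nat.card_zpowers]
  exact Subgroup.card_dvd_of_le (zpowers_le_centralizer x)

variable [Finite G]

lemma exists_orderOf_eq_three_sylow_le_centralizer (h3 : 3 ∣ Nat.card G) :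
    ∃ (P : Sylow 3 G) (x : G), x ∈ P ∧ orderOf x = 3 ∧
      (P : Subgroup G) ≤ Subgroup.centralizer {x} := by
  have : Fact (Nat.Prime 3) := ⟨Nat.prime_three⟩
  let P : Sylow 3 G := default
  have hP : Nontrivial P := by
    rw [← Finite.one_lt_card_iff_nontrivial]
    exact (by norm_num : 1 < 3).trans_le
      (Nat.le_of_dvd Nat.card_pos (P.dvd_card_of_dvd_card h3))
  have hZ := P.isPGroup'.center_nontrivial
  have hZp : IsPGroup 3 (Subgroup.center P) := P.isPGroup'.to_subgroup _
  obtain ⟨n, hn0, hn⟩ := hZp.nontrivial_iff_card.mp hZ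
  obtain ⟨x, hx⟩ := exists_prime_orderOf_dvd_card' (G := Subgroup.center P) 3
    (hn ▸ dvd_pow_self 3 hn0.ne')
  refine ⟨P, x, x.1.2, by rw [Subgroup.orderOf_coe, Subgroup.orderOf_coe, hx], fun g hg => ?_⟩
  rw [Subgroup.mem_centralizer_singleton_iff]
  exact congrArg Subtype.val (Subgroup.mem_center_iff.mp x.2 ⟨g, hg⟩)

lemma sum_bound_of_orderOf_eq_three {x : G} (hx : orderOf x = 3) :
    8 * (Nat.card G : ℤ) + Nat.card (Subgroup.centralizer {x})
      - 2 * Nat.card {g // g * x = x⁻¹ * g} - 6 ≤ 3 * psi G := by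
  classical
  have := Fintype.ofFinite G
  have hodd : Odd (orderOf x) := hx ▸ by decide
  have hx1 : x ≠ 1 := by rintro rfl; rw [orderOf_one] at hx; omega
  have key := sum_le_three_mul_psi x
    (fun g => 8 + (if g * x = x * g then (1 : ℤ) else 0)
      + (-2) * (if g * x = x⁻¹ * g then (1 : ℤ) else 0)
      + (-2) * (if g ∈ Subgroup.zpowers x then (1 : ℤ) else 0)) (by
      intro g
      by_cases hC : g * x = x * g
      · have h1 := seven_le_orderOf_sum hx hC
        have h2 := not_inverting_of_commute hodd hx1 hC
        rw [if_pos hC, if_neg h2]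
        by_cases hz : g ∈ Subgroup.zpowers x
        · rw [if_pos hz]
          omega
        · have := h1.2.1 hz
          rw [if_neg hz]
          omega
      · have hz : g ∉ Subgroup.zpowers x := fun hz =>
          hC (Subgroup.mem_centralizer_singleton_iff.mp (zpowers_le_centralizer x hz))
        rw [if_neg hC, if_neg hz]
        by_cases hI : g * x = x⁻¹ * g
        · have := six_le_orderOf_sum hC
          rw [if_pos hI]
          omega
        · have := (eight_le_orderOf_sum hodd hC hI).1
          rw [if_neg hI]
          omega)
  rw [sum_add_distrib, sum_add_distrib, sum_add_distrib, ← mul_sum, ← mul_sum,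
    sum_ite_one_eq_card, sum_ite_one_eq_card, sum_ite_one_eq_card, natCard_commuting_eq, sum_const,
    card_univ, ← Nat.card_eq_fintype_card, nsmul_eq_mul] at key
  have hz : Nat.card {g // g ∈ Subgroup.zpowers x} = 3 := hx ▸ Nat.card_zpowers x
  rw [hz] at key
  push_cast at key
  linarith

lemma natCard_orderOf_eq_mul_le {x : G} {d : ℕ} (h : ∀ y : G, orderOf y = d → IsConj x y) :
    Nat.card {y : G // orderOf y = d} * Nat.card (Subgroup.centralizer {x}) ≤ Nat.card G := by
  have h1 : Nat.card {y : G // orderOf y = d} ≤ (MulAction.orbit (ConjAct G) x).ncard := by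
    refine Set.ncard_le_ncard (s := {y : G | orderOf y = d}) (fun y hy => ?_) (Set.toFinite _)
    rw [ConjAct.mem_orbit_conjAct]
    exact (h y hy).symm
  rw [← MulAction.index_stabilizer] at h1
  rw [Subgroup.nat_card_centralizer_nat_card_stabilizer, mul_comm]
  refine (Nat.mul_le_mul_left _ h1).trans ?_
  rw [Subgroup.card_mul_index]
  exact le_rfl

lemma isConj_of_natCard_centralizer_eq_three {P : Sylow 3 G} {x t : G} (hxP : x ∈ P)
    (hx : orderOf x = 3) (hPC : (P : Subgroup G) ≤ Subgroup.centralizer {x})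
    (hc : Nat.card (Subgroup.centralizer {x}) = 3) (ht : t * x = x⁻¹ * t)
    {y : G} (hy : orderOf y = 3) : IsConj x y := by
  have : Fact (Nat.Prime 3) := ⟨Nat.prime_three⟩
  have hzC : Subgroup.zpowers x = Subgroup.centralizer {x} :=
    Subgroup.eq_of_le_of_card_ge (zpowers_le_centralizer x) (by rw [hc, Nat.card_zpowers, hx])
  have hyp : IsPGroup 3 (Subgroup.zpowers y) :=
    IsPGroup.of_card (n := 1) (by rw [Nat.card_zpowers, hy, pow_one])
  obtain ⟨Q, hQ⟩ := hyp.exists_le_sylow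
  obtain ⟨g, rfl⟩ := MulAction.exists_smul_eq G P Q
  have hyQ : y ∈ g • P := hQ (Subgroup.mem_zpowers y)
  have hxx : IsConj x x⁻¹ := isConj_iff.mpr ⟨t, by rw [ht, mul_inv_cancel_right]⟩
  obtain ⟨z, hz, rfl⟩ : ∃ z ∈ P, g * z * g⁻¹ = y := by
    obtain ⟨z, hz, h⟩ := hyQ
    exact ⟨z, hz, h⟩
  have hzy : IsConj z (g * z * g⁻¹) := isConj_iff.mpr ⟨g, rfl⟩
  rcases mem_zpowers_of_orderOf_eq_three hx (hzC ▸ hPC hz) with rfl | rfl | rfl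
  · simp at hy
  · exact hzy
  · exact hxx.trans hzy

lemma sum_bound_of_natCard_centralizer_eq_three {x : G} (hx : orderOf x = 3)
    (hc : Nat.card (Subgroup.centralizer {x}) = 3) :
    10 * (Nat.card G : ℤ) - 15 ≤ 3 * (psi G + Nat.card {y : G // orderOf y = 3}) := by
  classical
  have := Fintype.ofFinite G
  have hodd : Odd (orderOf x) := hx ▸ by decide
  have hx1 : x ≠ 1 := by rintro rfl; rw [orderOf_one] at hx; omega
  have hzC : Subgroup.zpowers x = Subgroup.centralizer {x} :=
    Subgroup.eq_of_le_of_card_ge (zpowers_le_centralizer x) (by rw [hc, Nat.card_zpowers, hx])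
  have key : ∑ g : G, (10 + (-1) * (if g * x = x * g then (1 : ℤ) else 0)
      + (-4) * (if g * x = x⁻¹ * g then (1 : ℤ) else 0)) ≤
      3 * ∑ g : G, ((orderOf g : ℤ) + if orderOf g = 3 then 1 else 0) := by
    rw [← sum_shift_eq x]
    refine Finset.sum_le_sum fun g _ => ?_
    by_cases hC : g * x = x * g
    · have h2 := not_inverting_of_commute hodd hx1 hC
      rw [if_pos hC, if_neg h2]
      have hz : g ∈ Subgroup.zpowers x := hzC ▸ Subgroup.mem_centralizer_singleton_iff.mpr hC
      have hx3 : x ^ 3 = 1 := hx ▸ pow_orderOf_eq_one x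
      have hx2 : x ^ 2 = x⁻¹ := by rw [eq_inv_iff_mul_eq_one, ← pow_succ, hx3]
      have hxx : x * x = x⁻¹ := by rw [← sq, hx2]
      have hxi : x⁻¹ * x⁻¹ = x := by rw [← mul_inv_rev, hxx, inv_inv]
      rcases mem_zpowers_of_orderOf_eq_three hx hz with rfl | rfl | rfl <;>
        simp [hx2, hx, hxx, hxi]
    · rw [if_neg hC]
      by_cases hI : g * x = x⁻¹ * g
      · have := six_le_orderOf_sum hC
        rw [if_pos hI]
        split_ifs <;> omega
      · have := (eight_le_orderOf_sum hodd hC hI).2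
        rw [if_neg hI]
        have := (Nat.cast_le (α := ℤ)).mpr this
        push_cast at this
        linarith
  rw [sum_add_distrib, sum_add_distrib, ← mul_sum, ← mul_sum, sum_add_distrib, ← psi_eq_sum,
    sum_ite_one_eq_card, sum_ite_one_eq_card, sum_ite_one_eq_card, natCard_commuting_eq, sum_const,
    card_univ, ← Nat.card_eq_fintype_card, nsmul_eq_mul, hc] at key
  have := natCard_inverting_le x
  rw [hc] at this
  push_cast at key
  linarith [(Nat.cast_le (α := ℤ)).mpr this]

lemma exists_inverting {x : G} (hx : orderOf x = 3) (h2 : 2 ∣ Nat.card G)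
    (hpsi : 12 * (psi G : ℤ) < 31 * Nat.card G) : ∃ t, t * x = x⁻¹ * t := by
  by_contra! hI
  have h := sum_bound_of_orderOf_eq_three hx
  have : IsEmpty {g // g * x = x⁻¹ * g} := ⟨fun g => hI g.1 g.2⟩
  have h0 : Nat.card {g // g * x = x⁻¹ * g} = 0 := Nat.card_of_isEmpty
  rw [h0] at h
  obtain ⟨k, hk⟩ := three_dvd_natCard_centralizer hx
  have hi := Subgroup.card_mul_index (Subgroup.centralizer {x})
  have hpos : 0 < Nat.card G := Nat.card_pos
  have hk0 : 0 < k := by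
    have : 0 < Nat.card (Subgroup.centralizer {x}) := Nat.card_pos
    omega
  have hk1 : k = 1 := by
    by_contra hk1
    have : Nat.card (Subgroup.centralizer {x}) ≤ Nat.card G := Subgroup.card_le_card_group _
    omega
  subst hk1
  have hidx : (Subgroup.centralizer {x}).index = 2 := by
    rw [hk] at hi h
    omega
  have hzC : Subgroup.zpowers x = Subgroup.centralizer {x} :=
    Subgroup.eq_of_le_of_card_ge (zpowers_le_centralizer x) (by rw [hk, Nat.card_zpowers, hx])
  have hN := Subgroup.normal_of_index_eq_two hidx
  have hC : Subgroup.centralizer {x} = ⊤ := by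
    refine (Subgroup.eq_top_iff' _).mpr fun g => ?_
    have hg := hN.conj_mem x (hzC ▸ Subgroup.mem_zpowers x) g
    rw [← hzC] at hg
    rw [Subgroup.mem_centralizer_singleton_iff]
    rcases mem_zpowers_of_orderOf_eq_three hx hg with h | h | h
    · rw [mul_inv_eq_one, mul_eq_left] at h
      simp [h] at hx
    · rwa [mul_inv_eq_iff_eq_mul] at h
    · rw [mul_inv_eq_iff_eq_mul] at h
      exact absurd h (hI g)
  rw [hC, Subgroup.index_top] at hidx
  omega

lemma index_invCentralizer_ne_two {x t : G} (hx : orderOf x = 3) (ht : t * x = x⁻¹ * t)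
    (hpsi : 12 * (psi G : ℤ) < 31 * Nat.card G) : (invCentralizer x).index ≠ 2 := by
  classical
  have := Fintype.ofFinite G
  intro hidx
  have hodd : Odd (orderOf x) := hx ▸ by decide
  have hx1 : x ≠ 1 := by rintro rfl; rw [orderOf_one] at hx; omega
  have hord (y : G) (hy : y ∉ invCentralizer x) : orderOf y ≠ 3 := by
    intro h3
    have h2 := Subgroup.sq_mem_of_index_two hidx y
    have : y ^ 3 = 1 := h3 ▸ pow_orderOf_eq_one y
    rw [pow_succ, mul_eq_one_iff_eq_inv] at this
    rw [this, inv_mem_iff] at h2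
    exact hy h2
  have hxN : x ∈ invCentralizer x := .inl rfl
  have key := sum_le_three_mul_psi x
    (fun g => 10 + (-1) * (if g * x = x * g then (1 : ℤ) else 0)
      + (-4) * (if g * x = x⁻¹ * g then (1 : ℤ) else 0)
      + (-2) * (if g ∈ Subgroup.zpowers x then (1 : ℤ) else 0)) (by
      intro g
      by_cases hC : g * x = x * g
      · have h1 := seven_le_orderOf_sum hx hC
        have h2 := not_inverting_of_commute hodd hx1 hC
        rw [if_pos hC, if_neg h2]
        by_cases hz : g ∈ Subgroup.zpowers x
        · rw [if_pos hz]
          omega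
        · have := h1.2.1 hz
          rw [if_neg hz]
          omega
      · have hz : g ∉ Subgroup.zpowers x := fun hz =>
          hC (Subgroup.mem_centralizer_singleton_iff.mp (zpowers_le_centralizer x hz))
        rw [if_neg hC, if_neg hz]
        by_cases hI : g * x = x⁻¹ * g
        · have := six_le_orderOf_sum hC
          rw [if_pos hI]
          omega
        · have hg : g ∉ invCentralizer x := by
            rw [mem_invCentralizer, not_or]
            exact ⟨hC, hI⟩
          have := (eight_le_orderOf_sum hodd hC hI).2
          rw [if_neg (hord _ hg), if_neg (hord _ (by rwa [Subgroup.mul_mem_cancel_right _ hxN])),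
            if_neg (hord _ (by rwa [Subgroup.mul_mem_cancel_right _ (pow_mem hxN 2)]))] at this
          rw [if_neg hI]
          omega)
  rw [sum_add_distrib, sum_add_distrib, sum_add_distrib, ← mul_sum, ← mul_sum, ← mul_sum,
    sum_ite_one_eq_card, sum_ite_one_eq_card, sum_ite_one_eq_card, natCard_commuting_eq,
    natCard_inverting_eq ht, sum_const,
    card_univ, ← Nat.card_eq_fintype_card, nsmul_eq_mul] at key
  have hz : Nat.card {g // g ∈ Subgroup.zpowers x} = 3 := hx ▸ Nat.card_zpowers x
  have hn := Subgroup.card_mul_index (invCentralizer x)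
  rw [hidx, natCard_invCentralizer hodd hx1 ht] at hn
  have : 0 < Nat.card (Subgroup.centralizer {x}) := Nat.card_pos
  obtain ⟨k, hk⟩ := three_dvd_natCard_centralizer hx
  rw [hz] at key
  push_cast at key
  omega

/-- In the situation of the main theorem, some subgroup of order three is normal and is inverted
by some element. -/
lemma exists_orderOf_eq_three_invCentralizer_eq_top (h2 : 2 ∣ Nat.card G) (h3 : 3 ∣ Nat.card G)
    (hpsi : 12 * (psi G : ℤ) < 31 * Nat.card G) :
    ∃ x t : G, orderOf x = 3 ∧ t * x = x⁻¹ * t ∧ invCentralizer x = ⊤ := by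
  have : Fact (Nat.Prime 3) := ⟨Nat.prime_three⟩
  obtain ⟨P, x, hxP, hx, hPC⟩ := exists_orderOf_eq_three_sylow_le_centralizer h3
  obtain ⟨t, ht⟩ := exists_inverting hx h2 hpsi
  refine ⟨x, t, hx, ht, ?_⟩
  have hodd : Odd (orderOf x) := hx ▸ by decide
  have hx1 : x ≠ 1 := by rintro rfl; rw [orderOf_one] at hx; omega
  have hl3 : ¬ 3 ∣ (invCentralizer x).index := by
    intro h
    refine P.not_dvd_index (h.trans (Subgroup.index_dvd_of_le fun g hg => .inl ?_))
    exact Subgroup.mem_centralizer_singleton_iff.mp (hPC hg)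
  have hl2 := index_invCentralizer_ne_two hx ht hpsi
  have hn := Subgroup.card_mul_index (invCentralizer x)
  rw [natCard_invCentralizer hodd hx1 ht] at hn
  have hb := sum_bound_of_orderOf_eq_three hx
  rw [natCard_inverting_eq ht] at hb
  have hc0 : 0 < Nat.card (Subgroup.centralizer {x}) := Nat.card_pos
  obtain ⟨k, hk⟩ := three_dvd_natCard_centralizer hx
  have hl0 : (invCentralizer x).index ≠ 0 := Subgroup.index_ne_zero_of_finite
  rw [← Subgroup.index_eq_one]
  set l := (invCentralizer x).index
  by_contra hl1
  have hl4 : 4 ≤ l := by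
    by_contra hl4
    interval_cases l <;> simp_all
  have hk0 : 0 < k := by omega
  have hsmall : k * (l - 2) < 4 := by
    zify [show 2 ≤ l by omega]
    zify at hn hk
    rw [hk] at hn hb
    rw [← hn] at hb hpsi
    nlinarith
  have hk1 : k = 1 := by
    by_contra hk1
    have : 2 * 2 ≤ k * (l - 2) := Nat.mul_le_mul (by omega) (by omega)
    omega
  subst hk1
  have h1 := sum_bound_of_natCard_centralizer_eq_three hx hk
  have h2 := natCard_orderOf_eq_mul_le (x := x) (d := 3) fun y hy =>
    isConj_of_natCard_centralizer_eq_three hxP hx hPC hk ht hy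
  rw [hk] at hn h2
  omega

end OrderThree

section Inverting

lemma Subgroup.eq_top_of_lt_two_mul_natCard {H : Type*} [Group H] [Finite H] {K : Subgroup H}
    (h : Nat.card H < 2 * Nat.card K) : K = ⊤ := by
  rw [← Subgroup.index_eq_one]
  have h0 : K.index ≠ 0 := Subgroup.index_ne_zero_of_finite
  have hi := K.card_mul_index
  by_contra h1
  have : Nat.card K * 2 ≤ Nat.card K * K.index := Nat.mul_le_mul_left _ (by omega)
  omega

/-- An endomorphism inverting more than three quarters of the elements inverts everything. -/
lemma map_eq_inv_of_three_mul_lt {H : Type*} [Group H] [Finite H] (φ : H →* H)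
    (h : 3 * Nat.card H < 4 * Nat.card {a // φ a = a⁻¹}) (a : H) : φ a = a⁻¹ := by
  classical
  have := Fintype.ofFinite H
  set S : Finset H := {a | φ a = a⁻¹} with hS
  have hcard : Nat.card {a // φ a = a⁻¹} = #S := by
    rw [Nat.card_eq_fintype_card, Fintype.card_subtype]
  rw [hcard] at h
  have hmem (b : H) : b ∈ S ↔ φ b = b⁻¹ := by simp [hS]
  have hle (K : Subgroup H) (T : Finset H) (hT : Nat.card H < 2 * #T) (hTK : ∀ b ∈ T, b ∈ K) :
      K = ⊤ := by
    refine Subgroup.eq_top_of_lt_two_mul_natCard (hT.trans_le ?_)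
    have : #T ≤ Nat.card K := by
      rw [← Set.ncard_coe_finset]
      exact Set.ncard_le_ncard (t := (K : Set H)) hTK (Set.toFinite _)
    omega
  have hS2 : Nat.card H < 2 * #S := by omega
  have hcomm (b : H) (hb : b ∈ S) (c : H) : c * b = b * c := by
    have htop : Subgroup.centralizer {b} = ⊤ := by
      refine hle _ (S ∩ S.image (b⁻¹ * ·)) ?_ fun d hd => ?_
      · have h1 := Finset.card_union_add_card_inter S (S.image (b⁻¹ * ·))
        rw [Finset.card_image_of_injective _ (mul_right_injective b⁻¹)] at h1
        have h2 : #(S ∪ S.image (b⁻¹ * ·)) ≤ Nat.card H := by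
          rw [Nat.card_eq_fintype_card]
          exact Finset.card_le_univ _
        omega
      · obtain ⟨hd, hd'⟩ := Finset.mem_inter.mp hd
        obtain ⟨e, he, rfl⟩ := Finset.mem_image.mp hd'
        rw [hmem] at hb he hd
        rw [Subgroup.mem_centralizer_singleton_iff]
        rw [map_mul, map_inv, hb, he, inv_inv, mul_inv_rev, inv_inv] at hd
        have hbe : Commute b e := by simpa using (show Commute b e⁻¹ from hd).inv_right
        exact (((Commute.refl b).inv_right).mul_right hbe).symm
    exact Subgroup.mem_centralizer_singleton_iff.mp (htop ▸ Subgroup.mem_top c)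
  have hcenter : Subgroup.center H = ⊤ :=
    hle _ S hS2 fun b hb => Subgroup.mem_center_iff.mpr (hcomm b hb)
  have hc (b c : H) : b * c = c * b :=
    Subgroup.mem_center_iff.mp (hcenter ▸ Subgroup.mem_top c) b
  let K : Subgroup H :=
    { carrier := {b | φ b = b⁻¹}
      one_mem' := by simp
      mul_mem' := fun {b c} (hb : φ b = b⁻¹) (hc' : φ c = c⁻¹) => by
        change φ (b * c) = (b * c)⁻¹
        rw [map_mul, hb, hc', ← mul_inv_rev, hc]
      inv_mem' := fun {b} (hb : φ b = b⁻¹) => by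
        change φ b⁻¹ = b⁻¹⁻¹
        rw [map_inv, hb] }
  have hK : K = ⊤ := hle K S hS2 fun b hb => (hmem b).mp hb
  exact (hK ▸ Subgroup.mem_top a : a ∈ K)

variable {G : Type*} [Group G] [Finite G]

lemma card_involutions_bound {x t : G} (hx : orderOf x = 3) (ht : t * x = x⁻¹ * t)
    (htop : invCentralizer x = ⊤) (hpsi : 12 * (psi G : ℤ) < 31 * Nat.card G) :
    11 * Nat.card (Subgroup.centralizer {x}) <
      12 * Nat.card {g : G // g * x = x⁻¹ * g ∧ g ^ 2 = 1} + 12 := by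
  classical
  have := Fintype.ofFinite G
  have hodd : Odd (orderOf x) := hx ▸ by decide
  have hx1 : x ≠ 1 := by rintro rfl; rw [orderOf_one] at hx; omega
  have hN (g : G) : g * x = x * g ∨ g * x = x⁻¹ * g := by
    rw [← mem_invCentralizer, htop]
    trivial
  have hfour (g : G) (hI : g * x = x⁻¹ * g) (h2 : g ^ 2 ≠ 1) : 4 ≤ orderOf g := by
    refine four_le_orderOf h2 fun h3 => ?_
    have hI' : SemiconjBy g x x⁻¹ := hI
    have hsq : Commute (g ^ 2) x := by
      have := hI'.inv_right.mul_left hI'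
      rwa [inv_inv, ← sq] at this
    have h4 : g ^ 3 = 1 := h3 ▸ pow_orderOf_eq_one g
    rw [pow_succ, mul_eq_one_iff_inv_eq] at h4
    exact not_inverting_of_commute hodd hx1 (h4 ▸ hsq.inv_left) hI
  have hshift (g : G) (hI : g * x = x⁻¹ * g) : (g * x) * x = x⁻¹ * (g * x) ∧
      (g * x) ^ 2 = g ^ 2 := by
    refine ⟨by rw [hI, mul_assoc, hI], ?_⟩
    calc (g * x) ^ 2 = g * x * (g * x) := sq _
      _ = g * x * (x⁻¹ * g) := by rw [hI]
      _ = g ^ 2 := by rw [mul_assoc, mul_inv_cancel_left, sq]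
  have key := sum_le_three_mul_psi x
    (fun g => 9 * (if g * x = x * g then (1 : ℤ) else 0)
      + 12 * (if g * x = x⁻¹ * g then (1 : ℤ) else 0)
      + (-6) * (if g * x = x⁻¹ * g ∧ g ^ 2 = 1 then (1 : ℤ) else 0)
      + (-2) * (if g ∈ Subgroup.zpowers x then (1 : ℤ) else 0)) (by
      intro g
      by_cases hC : g * x = x * g
      · have h1 := seven_le_orderOf_sum hx hC
        have h2 := not_inverting_of_commute hodd hx1 hC
        rw [if_pos hC, if_neg h2, if_neg (fun h => h2 h.1)]
        by_cases hz : g ∈ Subgroup.zpowers x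
        · rw [if_pos hz]
          omega
        · have := h1.2.1 hz
          rw [if_neg hz]
          omega
      · have hz : g ∉ Subgroup.zpowers x := fun hz =>
          hC (Subgroup.mem_centralizer_singleton_iff.mp (zpowers_le_centralizer x hz))
        have hI := (hN g).resolve_left hC
        rw [if_neg hC, if_neg hz, if_pos hI]
        by_cases hsq : g ^ 2 = 1
        · have := six_le_orderOf_sum hC
          rw [if_pos ⟨hI, hsq⟩]
          omega
        · have h1 := hshift g hI
          have h2 := hshift (g * x) h1.1
          rw [h1.2, mul_assoc g, ← sq x] at h2
          have := hfour g hI hsq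
          have := hfour (g * x) h1.1 (h1.2 ▸ hsq)
          have := hfour (g * x ^ 2) h2.1 (h2.2 ▸ hsq)
          rw [if_neg (fun h => hsq h.2)]
          omega)
  rw [sum_add_distrib, sum_add_distrib, sum_add_distrib, ← mul_sum, ← mul_sum, ← mul_sum,
    ← mul_sum, sum_ite_one_eq_card, sum_ite_one_eq_card, sum_ite_one_eq_card, sum_ite_one_eq_card,
    natCard_commuting_eq, natCard_inverting_eq ht] at key
  have hz : Nat.card {g // g ∈ Subgroup.zpowers x} = 3 := hx ▸ Nat.card_zpowers x
  have hn := natCard_invCentralizer hodd hx1 ht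
  rw [htop, Subgroup.card_top] at hn
  rw [hz] at key
  push_cast at key
  omega

/-- Some element inverts `⟨x⟩` and the whole centralizer of `x`. -/
lemma exists_inverting_centralizer {x t : G} (hx : orderOf x = 3) (ht : t * x = x⁻¹ * t)
    (htop : invCentralizer x = ⊤) (hpsi : 12 * (psi G : ℤ) < 31 * Nat.card G) :
    ∃ s : G, s * x = x⁻¹ * s ∧ s ^ 2 = 1 ∧
      ∀ a ∈ Subgroup.centralizer {x}, s * a * s⁻¹ = a⁻¹ := by
  classical
  have hodd : Odd (orderOf x) := hx ▸ by decide
  have hx1 : x ≠ 1 := by rintro rfl; rw [orderOf_one] at hx; omega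
  have hcard := natCard_invCentralizer hodd hx1 ht
  rw [htop, Subgroup.card_top] at hcard
  have hC0 : 0 < Nat.card (Subgroup.centralizer {x}) := Nat.card_pos
  have hidx : (Subgroup.centralizer {x}).index = 2 := by
    have := (Subgroup.centralizer {x}).card_mul_index
    rw [hcard, mul_comm 2] at this
    exact Nat.eq_of_mul_eq_mul_left hC0 this
  have hnorm := Subgroup.normal_of_index_eq_two hidx
  have hbound := card_involutions_bound hx ht htop hpsi
  obtain ⟨k, hk⟩ := three_dvd_natCard_centralizer hx
  have hpos : 0 < Nat.card {g : G // g * x = x⁻¹ * g ∧ g ^ 2 = 1} := by omega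
  obtain ⟨⟨s, hs, hs2⟩⟩ := (Nat.card_pos_iff.mp hpos).1
  refine ⟨s, hs, hs2, ?_⟩
  have hss : s⁻¹ = s := inv_eq_of_mul_eq_one_right (by rw [← sq, hs2])
  let φ : Subgroup.centralizer {x} →* Subgroup.centralizer {x} :=
    (MulAut.conjNormal s).toMonoidHom
  have hφ (a : Subgroup.centralizer {x}) : (φ a : G) = s * a * s⁻¹ := rfl
  have hle : Nat.card {g : G // g * x = x⁻¹ * g ∧ g ^ 2 = 1} ≤ Nat.card {a // φ a = a⁻¹} := by
    refine Nat.card_le_card_of_injective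
      (fun g => ⟨⟨s * g.1, ?_⟩, ?_⟩) fun g h hgh => ?_
    · rw [Subgroup.mem_centralizer_singleton_iff, mul_assoc, g.2.1, ← mul_assoc, ← hss]
      have : SemiconjBy s⁻¹ x⁻¹ x := SemiconjBy.inv_symm_left hs
      rw [this.eq, mul_assoc]
    · rw [Subtype.ext_iff, hφ]
      have hg : g.1⁻¹ = g.1 := inv_eq_of_mul_eq_one_right (by rw [← sq, g.2.2])
      change s * (s * g.1) * s⁻¹ = (s * g.1)⁻¹
      rw [← mul_assoc, ← sq, hs2, one_mul, mul_inv_rev, hg]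
    · have : s * g.1 = s * h.1 := congrArg (fun z => (z.1 : G)) hgh
      exact Subtype.ext (mul_left_cancel this)
  have hlt : 3 * Nat.card (Subgroup.centralizer {x}) < 4 * Nat.card {a // φ a = a⁻¹} := by
    by_cases hk1 : k = 1
    · have hzC : Subgroup.zpowers x = Subgroup.centralizer {x} :=
        Subgroup.eq_of_le_of_card_ge (zpowers_le_centralizer x)
          (by rw [hk, Nat.card_zpowers, hx, hk1])
      have hall (a : Subgroup.centralizer {x}) : φ a = a⁻¹ := by
        rw [Subtype.ext_iff, hφ, Subgroup.coe_inv]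
        rcases mem_zpowers_of_orderOf_eq_three hx (hzC.ge a.2) with h | h | h <;> rw [h]
        · simp
        · rw [hs, mul_inv_cancel_right]
        · have : SemiconjBy s x⁻¹ x⁻¹⁻¹ := SemiconjBy.inv_right hs
          rw [this.eq, mul_inv_cancel_right]
      rw [Nat.card_congr (Equiv.subtypeUnivEquiv hall)]
      omega
    · omega
  intro a ha
  have := map_eq_inv_of_three_mul_lt φ hlt ⟨a, ha⟩
  rw [Subtype.ext_iff] at this
  exact this

lemma clauseC_of_even (h2 : 2 ∣ Nat.card G) (h3 : 3 ∣ Nat.card G)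
    (hpsi : 12 * (psi G : ℤ) < 31 * Nat.card G) : ClauseC G := by
  classical
  have := Fintype.ofFinite G
  have : Fact (Nat.Prime 3) := ⟨Nat.prime_three⟩
  obtain ⟨x, t, hx, ht, htop⟩ := exists_orderOf_eq_three_invCentralizer_eq_top h2 h3 hpsi
  obtain ⟨s, hs, hs2, hinv⟩ := exists_inverting_centralizer hx ht htop hpsi
  have hodd : Odd (orderOf x) := hx ▸ by decide
  have hx1 : x ≠ 1 := by rintro rfl; rw [orderOf_one] at hx; omega
  have hcard := natCard_invCentralizer hodd hx1 ht
  rw [htop, Subgroup.card_top] at hcard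
  set C := Subgroup.centralizer {x} with hCdef
  have hCx (g : G) : g ∈ C ↔ g * x = x * g := Subgroup.mem_centralizer_singleton_iff
  have hC0 : 0 < Nat.card C := Nat.card_pos
  have hidx : C.index = 2 := by
    have := C.card_mul_index
    rw [hcard, mul_comm 2] at this
    exact Nat.eq_of_mul_eq_mul_left hC0 this
  have hnorm := Subgroup.normal_of_index_eq_two hidx
  have hsC : s ∉ C := fun h => not_inverting_of_commute hodd hx1 ((hCx s).mp h) hs
  have hcomm (a b : G) (ha : a ∈ C) (hb : b ∈ C) : a * b = b * a := by
    have h1 := hinv (a * b) (C.mul_mem ha hb)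
    rw [← conj_mul, hinv a ha, hinv b hb, mul_inv_rev] at h1
    have h4 := congrArg (·⁻¹) h1
    simpa using h4.symm
  have hout (g : G) (hg : g ∉ C) : g ^ 2 = 1 := by
    have hsg : s * g ∈ C := by
      rw [Subgroup.mul_mem_iff_of_index_two hidx]
      exact iff_of_false hsC hg
    have h1 := hinv _ hsg
    rw [← mul_assoc, ← sq, hs2, one_mul, mul_inv_rev, mul_left_inj] at h1
    rw [sq, mul_eq_one_iff_eq_inv]
    exact h1
  have hord2 (g : G) (hg : g ∉ C) : orderOf g = 2 :=
    orderOf_eq_prime (hout g hg) (by rintro rfl; exact hg C.one_mem)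
  obtain ⟨k, hk⟩ : 3 ∣ Nat.card C := three_dvd_natCard_centralizer hx
  have hcube (g : G) (hg : g ∈ C) : g ^ 3 = 1 := by
    let E : Subgroup G :=
      { carrier := {g | g ∈ C ∧ g ^ 3 = 1}
        one_mem' := ⟨C.one_mem, one_pow 3⟩
        mul_mem' := fun {a b} ha hb => ⟨C.mul_mem ha.1 hb.1, by
          rw [(show Commute a b from hcomm a b ha.1 hb.1).mul_pow, ha.2, hb.2, one_mul]⟩
        inv_mem' := fun {a} ha => ⟨C.inv_mem ha.1, by rw [inv_pow, ha.2, inv_one]⟩ }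
    have hEC : E ≤ C := fun a ha => ha.1
    by_contra hg3
    have hE : 2 * Nat.card E ≤ Nat.card C := by
      obtain ⟨m, hm⟩ := Subgroup.card_dvd_of_le hEC
      have hm0 : m ≠ 0 := by rintro rfl; omega
      have hm1 : m ≠ 1 := by
        rintro rfl
        have hEC' : E = C := Subgroup.eq_of_le_of_card_ge hEC (by rw [hm, mul_one])
        rw [← hEC'] at hg
        exact hg3 hg.2
      rw [hm, mul_comm 2]
      exact Nat.mul_le_mul_left _ (by omega)
    have key := sum_le_three_mul_psi x
      (fun g => 14 * (if g * x = x * g then (1 : ℤ) else 0)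
        + 6 * (if g * x = x⁻¹ * g then (1 : ℤ) else 0)
        + (-5) * (if g ∈ E then (1 : ℤ) else 0)
        + (-2) * (if g ∈ Subgroup.zpowers x then (1 : ℤ) else 0)) (by
        intro g
        by_cases hC : g * x = x * g
        · have h1 := seven_le_orderOf_sum hx hC
          have h2 := not_inverting_of_commute hodd hx1 hC
          rw [if_pos hC, if_neg h2]
          by_cases hgE : g ∈ E
          · rw [if_pos hgE]
            by_cases hz : g ∈ Subgroup.zpowers x
            · rw [if_pos hz]
              omega
            · have := h1.2.1 hz
              rw [if_neg hz]
              omega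
          · have := h1.2.2 fun h => hgE ⟨(hCx g).mpr hC, h⟩
            rw [if_neg hgE]
            split_ifs <;> omega
        · have hgE : g ∉ E := fun h => hC ((hCx g).mp h.1)
          have := six_le_orderOf_sum hC
          rw [if_neg hC, if_neg hgE]
          split_ifs <;> omega)
    rw [sum_add_distrib, sum_add_distrib, sum_add_distrib, ← mul_sum, ← mul_sum, ← mul_sum,
      ← mul_sum, sum_ite_one_eq_card, sum_ite_one_eq_card, sum_ite_one_eq_card,
      sum_ite_one_eq_card, natCard_commuting_eq, natCard_inverting_eq ht, ← hCdef] at key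
    have hz : Nat.card {g // g ∈ Subgroup.zpowers x} = 3 := hx ▸ Nat.card_zpowers x
    rw [hz] at key
    push_cast at key
    have hE' : Nat.card {g // g ∈ E} = Nat.card E := rfl
    omega
  have hord3 (g : G) (hg : g ∈ C) (hg1 : g ≠ 1) : orderOf g = 3 :=
    orderOf_eq_prime (hcube g hg) hg1
  have hCp : IsPGroup 3 C := fun g => ⟨1, Subtype.ext (by simpa using hcube g g.2)⟩
  obtain ⟨m, hm⟩ := hCp.exists_card_eq
  refine ⟨m, C, ?_, hnorm, hm, hidx, fun a ha b hb => hcomm a b ha hb, hord3, hord2, ?_⟩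
  · rw [Nat.one_le_iff_ne_zero]
    rintro rfl
    omega
  · have hpsi' : (psi G : ℤ) = 5 * 3 ^ m - 2 := by
      have hsum : (psi G : ℤ) = ∑ g : G, (2 + (if g ∈ C then (1 : ℤ) else 0)
          + (-2) * (if g = 1 then (1 : ℤ) else 0)) := by
        rw [psi_eq_sum]
        refine Finset.sum_congr rfl fun g _ => ?_
        by_cases hg1 : g = 1
        · subst hg1
          simp [C.one_mem]
        · by_cases hg : g ∈ C
          · simp [hg, hg1, hord3 g hg hg1]
          · simp [hg, hg1, hord2 g hg]
      rw [hsum, sum_add_distrib, sum_add_distrib, ← mul_sum, sum_ite_one_eq_card,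
        sum_ite_one_eq_card, sum_const, card_univ, ← Nat.card_eq_fintype_card, nsmul_eq_mul, hcard]
      have h1 : Nat.card {g : G // g = 1} = 1 := by simp
      have hC' : Nat.card {g // g ∈ C} = 3 ^ m := hm
      rw [h1, hC']
      push_cast
      ring
    have hq : (psi G : ℚ) = 5 * 3 ^ m - 2 := by exact_mod_cast hpsi'
    rw [avgOrder, hq, hcard, hm]
    push_cast
    rfl

end Inverting

lemma not_dvd_of_pow {p q k : ℕ} (hp : p.Prime) (hq : q.Prime) (h : p ≠ q) : ¬ p ∣ q ^ k :=
  fun hd => h ((Nat.prime_dvd_prime_iff_eq hp hq).mp (hp.dvd_of_dvd_pow hd))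

lemma IsPGroup.orderOf_ne_three {G : Type*} [Group G] (hG : IsPGroup 2 G) (g : G) :
    orderOf g ≠ 3 := by
  intro h3
  have : Fact (Nat.Prime 2) := ⟨Nat.prime_two⟩
  obtain ⟨k, hk⟩ := hG.exists_orderOf_eq_pow g
  exact not_dvd_of_pow Nat.prime_three Nat.prime_two (by norm_num) (k := k) (by rw [← hk, h3])

section TwoGroup

variable {G : Type*} [Group G] [Finite G]

lemma IsPGroup.commutator_le_frattini {p : ℕ} [Fact p.Prime] (hG : IsPGroup p G) :
    commutator G ≤ frattini G := by
  have := hG.isNilpotent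
  refine le_iInf₂ fun M hM => ?_
  have hM' : IsCoatom M := hM
  have hnorm : M.Normal := Subgroup.NormalizerCondition.normal_of_coatom M
    Group.normalizerCondition_of_isNilpotent hM'
  obtain ⟨g, hg⟩ : ∃ g, g ∉ M := by
    by_contra! h
    exact hM'.1 ((Subgroup.eq_top_iff' M).mpr h)
  refine Subgroup.Normal.commutator_le_of_self_sup_commutative_eq_top
    (H := Subgroup.zpowers g) ?_ inferInstance
  refine hM'.2 _ (lt_of_le_of_ne le_sup_left fun h => hg ?_)
  rw [h]
  exact Subgroup.mem_sup_right (Subgroup.mem_zpowers g)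

lemma frattini_le_commutator_of_sq_mem (h : ∀ g : G, g ^ 2 ∈ commutator G) :
    frattini G ≤ commutator G := by
  intro y hy
  by_contra hyG
  obtain ⟨K, hGK, hK⟩ := (Set.toFinite {K : Subgroup G | y ∉ K}).exists_le_maximal hyG
  have hnorm : K.Normal := ⟨fun n hn g => by
    have : g * n * g⁻¹ * n⁻¹ ∈ K :=
      hGK (Subgroup.commutator_mem_commutator (Subgroup.mem_top g) (Subgroup.mem_top n))
    rwa [Subgroup.mul_mem_cancel_right _ (K.inv_mem hn)] at this⟩
  have hmem (L : Subgroup G) (hKL : K < L) : y ∈ L := by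
    by_contra hyL
    exact hKL.not_ge (hK.2 hyL hKL.le)
  refine hK.1 (frattini_le_coatom
    ⟨fun hK' => hK.1 (hK'.ge (Subgroup.mem_top y)), fun L hKL => ?_⟩ hy)
  refine (Subgroup.eq_top_iff' L).mpr fun g => ?_
  by_cases hg : g ∈ K
  · exact hKL.le hg
  have hyg : y ∈ K ⊔ Subgroup.zpowers g := hmem _ <| lt_of_le_of_ne le_sup_left fun h' =>
    hg (h' ▸ Subgroup.mem_sup_right (Subgroup.mem_zpowers g))
  obtain ⟨k, hk, z, hz, rfl⟩ := Subgroup.mem_sup_of_normal_left.mp hyg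
  obtain ⟨n, rfl⟩ := Subgroup.mem_zpowers_iff.mp hz
  have hsq : g ^ 2 ∈ K := hGK (h g)
  have hyL := hmem L hKL
  rw [Subgroup.mul_mem_cancel_left _ (hKL.le hk)] at hyL
  obtain ⟨m, rfl | rfl⟩ := Int.even_or_odd' n
  · refine absurd (K.mul_mem hk ?_) hK.1
    rw [zpow_mul]
    exact K.zpow_mem (by exact_mod_cast hsq) m
  · rwa [zpow_add, zpow_one, zpow_mul, Subgroup.mul_mem_cancel_left] at hyL
    exact hKL.le (K.zpow_mem (by exact_mod_cast hsq) m)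

lemma sq_mem_commutator (hG : IsPGroup 2 G) (hpsi : 12 * (psi G : ℤ) < 31 * Nat.card G) (g : G) :
    g ^ 2 ∈ commutator G := by
  classical
  have := Fintype.ofFinite G
  let φ : G →* Abelianization G := (powMonoidHom 2).comp Abelianization.of
  have hφ (y : G) : y ∈ φ.ker ↔ y ^ 2 ∈ commutator G := by
    rw [← Abelianization.ker_of, MonoidHom.mem_ker, MonoidHom.mem_ker, map_pow]
    rfl
  rw [← hφ]
  by_contra hg
  have hfour (y : G) (hy : y ∉ φ.ker) : 4 ≤ orderOf y := by
    refine four_le_orderOf (fun h => hy ?_) (hG.orderOf_ne_three y)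
    rw [hφ, h]
    exact one_mem _
  have hker : 2 * Nat.card φ.ker ≤ Nat.card G := by
    have hi := φ.ker.card_mul_index
    have h0 : φ.ker.index ≠ 0 := Subgroup.index_ne_zero_of_finite
    have h1 : φ.ker.index ≠ 1 := fun h => by
      rw [Subgroup.index_eq_one] at h
      exact hg (h ▸ Subgroup.mem_top g)
    rw [← hi, mul_comm 2]
    exact Nat.mul_le_mul_left _ (by omega)
  have key : ∑ y : G, (4 + (-2) * (if y ∈ φ.ker then (1 : ℤ) else 0)
      + (-1) * (if y = 1 then (1 : ℤ) else 0)) ≤ psi G := by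
    rw [psi_eq_sum]
    refine Finset.sum_le_sum fun y _ => ?_
    by_cases hy1 : y = 1
    · subst hy1
      simp [φ.ker.one_mem]
    · have := two_le_orderOf hy1
      by_cases hy : y ∈ φ.ker
      · rw [if_pos hy, if_neg hy1]
        omega
      · have := hfour y hy
        rw [if_neg hy, if_neg hy1]
        omega
  rw [sum_add_distrib, sum_add_distrib, ← mul_sum, ← mul_sum, sum_ite_one_eq_card,
    sum_ite_one_eq_card, sum_const, card_univ, ← Nat.card_eq_fintype_card, nsmul_eq_mul] at key
  have h1 : Nat.card {y : G // y = 1} = 1 := by simp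
  have hk' : Nat.card {y // y ∈ φ.ker} = Nat.card φ.ker := rfl
  have h4 : 4 ≤ Nat.card G := (hfour g hg).trans
    (Nat.le_of_dvd Nat.card_pos (orderOf_dvd_natCard g))
  rw [h1, hk'] at key
  push_cast at key
  omega

lemma clauseA_of_isPGroup (hG : IsPGroup 2 G) (hpsi : 12 * (psi G : ℤ) < 31 * Nat.card G) :
    ClauseA G := by
  classical
  have := Fintype.ofFinite G
  refine ⟨hG.exists_card_eq, le_antisymm hG.commutator_le_frattini
    (frattini_le_commutator_of_sq_mem (sq_mem_commutator hG hpsi)), ?_⟩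
  have key : ∑ y : G, (4 + (-2) * (if orderOf y = 2 then (1 : ℤ) else 0)
      + (-3) * (if y = 1 then (1 : ℤ) else 0)) ≤ psi G := by
    rw [psi_eq_sum]
    refine Finset.sum_le_sum fun y _ => ?_
    by_cases hy1 : y = 1
    · subst hy1
      simp
    · have := two_le_orderOf hy1
      have := hG.orderOf_ne_three y
      rw [if_neg hy1]
      split_ifs <;> omega
  rw [sum_add_distrib, sum_add_distrib, ← mul_sum, ← mul_sum, sum_ite_one_eq_card,
    sum_ite_one_eq_card, sum_const, card_univ, ← Nat.card_eq_fintype_card, nsmul_eq_mul] at key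
  have h1 : Nat.card {y : G // y = 1} = 1 := by simp
  have hn : Nat.card {y : G // orderOf y = 2} = nOrd G 2 := rfl
  rw [h1, hn] at key
  have h17 : 17 * (Nat.card G : ℤ) < 24 * nOrd G 2 + 36 := by
    push_cast at key
    omega
  have h17' : 17 * (Nat.card G : ℚ) < 24 * nOrd G 2 + 36 := by exact_mod_cast h17
  linarith

end TwoGroup

section Odd

variable {G : Type*} [Group G] [Finite G]

lemma natCard_eq_three_of_odd (h2 : ¬ 2 ∣ Nat.card G) (h1 : Nat.card G ≠ 1)
    (hpsi : 12 * (psi G : ℤ) < 31 * Nat.card G) : Nat.card G = 3 := by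
  classical
  have := Fintype.ofFinite G
  have key : ∑ y : G, (3 + (-2) * (if y = 1 then (1 : ℤ) else 0)) ≤ psi G := by
    rw [psi_eq_sum]
    refine Finset.sum_le_sum fun y _ => ?_
    by_cases hy1 : y = 1
    · subst hy1
      simp
    · have := two_le_orderOf hy1
      have : orderOf y ≠ 2 := fun h => h2 (h ▸ orderOf_dvd_natCard y)
      rw [if_neg hy1]
      omega
  rw [sum_add_distrib, ← mul_sum, sum_ite_one_eq_card, sum_const, card_univ,
    ← Nat.card_eq_fintype_card, nsmul_eq_mul] at key
  have hone : Nat.card {y : G // y = 1} = 1 := by simp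
  have hpos : 0 < Nat.card G := Nat.card_pos
  rw [hone] at key
  push_cast at key
  omega

end Odd

/-- If a finite group `G` satisfies `o(G) < 31/12`, then exactly one of the
clauses (a), (b), (c) holds. -/
theorem stmt_2 (G : Type*) [Group G] [Finite G] (h : avgOrder G < 31 / 12) :
    (ClauseA G ∧ ¬ClauseB G ∧ ¬ClauseC G) ∨
    (¬ClauseA G ∧ ClauseB G ∧ ¬ClauseC G) ∨
    (¬ClauseA G ∧ ¬ClauseB G ∧ ClauseC G) := by
  have hpsi := twelve_mul_psi_lt h
  have hA : ClauseA G → ¬ 3 ∣ Nat.card G := by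
    rintro ⟨⟨k, hk⟩, -⟩
    rw [hk]
    exact not_dvd_of_pow Nat.prime_three Nat.prime_two (by norm_num)
  have hB : ClauseB G → Nat.card G = 3 := by
    rintro ⟨e⟩
    rw [Nat.card_congr e.toEquiv, Nat.card_congr Multiplicative.toAdd, Nat.card_zmod]
  have hC : ClauseC G → 2 ∣ Nat.card G ∧ 3 ∣ Nat.card G := by
    rintro ⟨m, K, hm, -, hK, hidx, -⟩
    rw [← K.card_mul_index, hK, hidx]
    exact ⟨dvd_mul_left 2 _, (dvd_pow_self 3 (by omega)).mul_right 2⟩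
  have hABC : ClauseA G ∨ ClauseB G ∨ ClauseC G := by
    by_cases h3 : 3 ∣ Nat.card G
    · by_cases h2 : 2 ∣ Nat.card G
      · exact .inr (.inr (clauseC_of_even h2 h3 hpsi))
      · have hcard := natCard_eq_three_of_odd h2 (by omega) hpsi
        have : Fact (Nat.Prime 3) := ⟨Nat.prime_three⟩
        refine .inr (.inl ⟨mulEquivOfPrimeCardEq hcard ?_⟩)
        rw [Nat.card_congr Multiplicative.toAdd, Nat.card_zmod]
    · have : Fact (Nat.Prime 2) := ⟨Nat.prime_two⟩
      refine .inl (clauseA_of_isPGroup (IsPGroup.of_card (n := (Nat.card G).primeFactorsList.length)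
        (Nat.eq_prime_pow_of_unique_prime_dvd Nat.card_pos.ne' fun {q} hq hqG => ?_)) hpsi)
      by_contra hq2
      have hq3 : q ≠ 3 := by rintro rfl; exact h3 hqG
      have hq4 : q ≠ 4 := by rintro rfl; exact absurd hq (by norm_num)
      have := hq.two_le
      have := five_le_prime_bound hq (by omega) hqG
      have : 0 < Nat.card G := Nat.card_pos
      omega
  have hAB : ClauseA G → ¬ ClauseB G := fun a b => hA a (by rw [hB b])
  have hAC : ClauseA G → ¬ ClauseC G := fun a c => hA a (hC c).2
  have hBC : ClauseB G → ¬ ClauseC G := fun b c => by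
    have := (hC c).1
    rw [hB b] at this
    omega
  tauto
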